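/- Every OPE-algebra V satisfies skew-symmetry for 𝐓=𝐓_1: (−1)^{|a||b|} b_(𝐧)a = Σ_{𝐢=(i,ī)∈ℕ²} (−1)^{(n+i)−(n̄+ī)} T_1^{(i)}T̄_1^{(ī)}(a_{(𝐧+𝐢)}b) for all homogeneous a,b∈V and all 𝐧=(n,n̄)∈𝕂̄ (the sums being finite). Moreover V is unital: the weak right identity 1 is a two-sided identity, i.e. Y(1) = 1(z) = id_V, and 1 is a right identity (every Ya is creative for 1 and 𝐓_1). -/

import Mathlib

open scoped BigOperators Classical

noncomputable section

namespace OPEA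

variable (K : Type*) [Field K] [CharZero K]

/-- index pairs 𝐧 = (n, n̄) ∈ K² -/
abbrev Idx := K × K

def IsInt (x : K) : Prop := ∃ k : ℤ, (k : K) = x

def IsNegInt (x : K) : Prop := ∃ k : ℤ, k < 0 ∧ (k : K) = x

/-- 𝕂̄ = {𝐧 ∈ K² | n − n̄ ∈ ℤ} -/
def Kbar (n : Idx K) : Prop := IsInt K (n.1 - n.2)

def IsIntPair (n : Idx K) : Prop := IsInt K n.1 ∧ IsInt K n.2

/-- generalized binomial coefficient C(x,k) -/
def gchoose (x : K) (k : ℕ) : K :=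
  (∏ i ∈ Finset.range k, (x - (i : K))) / (k.factorial : K)

/-- (−1)^x for x an integer image in K (and 1 otherwise) -/
def negOnePow (x : K) : K :=
  if h : ∃ k : ℤ, (k : K) = x then (-1 : K) ^ h.choose else 1

variable (M : Type*) [AddCommGroup M] [Module K M]

/-- M-valued distribution in one variable pair -/
abbrev Dist1 := Idx K → M

/-- M-valued distribution in two variable pairs -/
abbrev Dist2 := Idx K → Idx K → M

/-- M-valued distribution in r variable pairs -/
abbrev DistN (r : ℕ) := (Fin r → Idx K) → M

/-- membership in M[[𝐳]] -/
def IsPow1 (a : Dist1 K M) : Prop := ∀ n, a n ≠ 0 → IsNegInt K n.1 ∧ IsNegInt K n.2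

/-- membership in M⌊𝐳⌋ -/
def InLat1 (a : Dist1 K M) : Prop :=
  ∃ S : Finset (Idx K), ∀ n, a n ≠ 0 →
    ∃ m ∈ S, IsNegInt K (n.1 - m.1) ∧ IsNegInt K (n.2 - m.2)

/-- membership in M[[𝐳,𝐰]] -/
def IsPow2 (a : Dist2 K M) : Prop :=
  ∀ n k, a n k ≠ 0 →
    (IsNegInt K n.1 ∧ IsNegInt K n.2) ∧ (IsNegInt K k.1 ∧ IsNegInt K k.2)

/-- membership in M⌊𝐳,𝐰⌋ -/
def InLat2 (a : Dist2 K M) : Prop :=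
  ∃ S : Finset (Idx K × Idx K), ∀ n k, a n k ≠ 0 →
    ∃ m ∈ S, (IsNegInt K (n.1 - m.1.1) ∧ IsNegInt K (n.2 - m.1.2)) ∧
      (IsNegInt K (k.1 - m.2.1) ∧ IsNegInt K (k.2 - m.2.2))

/-- membership in M[[𝐳₁,…,𝐳ᵣ]] -/
def IsPowN {r : ℕ} (a : DistN K M r) : Prop :=
  ∀ n, a n ≠ 0 → ∀ i, IsNegInt K (n i).1 ∧ IsNegInt K (n i).2

/-- membership in M⌊𝐳₁,…,𝐳ᵣ⌋ -/
def InLatN {r : ℕ} (a : DistN K M r) : Prop :=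
  ∃ S : Finset (Fin r → Idx K), ∀ n, a n ≠ 0 →
    ∃ m ∈ S, ∀ i, IsNegInt K ((n i).1 - (m i).1) ∧ IsNegInt K ((n i).2 - (m i).2)

/-- ∂_z -/
def dz (a : Dist1 K M) : Dist1 K M := fun n => (-n.1) • a (n.1 - 1, n.2)

/-- ∂_z̄ -/
def dzb (a : Dist1 K M) : Dist1 K M := fun n => (-n.2) • a (n.1, n.2 - 1)

/-- ∂ in the first variable pair of a two-variable distribution (z-component) -/
def d1z (c : Dist2 K M) : Dist2 K M := fun n k => (-n.1) • c (n.1 - 1, n.2) k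

/-- ∂ in the first variable pair of a two-variable distribution (z̄-component) -/
def d1zb (c : Dist2 K M) : Dist2 K M := fun n k => (-n.2) • c (n.1, n.2 - 1) k

/-- divided power d^{(x)} of an operator d, for a K-valued exponent x
(zero unless x ∈ ℕ) -/
def dPow {A : Type*} [AddCommGroup A] [Module K A] (d : A → A) (x : K) (a : A) : A :=
  if h : ∃ j : ℕ, (j : K) = x then ((h.choose.factorial : K))⁻¹ • d^[h.choose] a else 0

/-- ∂_z^{(e_1)} ∂_z̄^{(e_2)} in the first variable pair -/
def ddPow2 (e : Idx K) (c : Dist2 K M) : Dist2 K M :=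
  dPow K (d1z K M) e.1 (dPow K (d1zb K M) e.2 c)

/-- the diagonal map c(𝐳,𝐰) ↦ c(𝐰,𝐰) -/
def diag (c : Dist2 K M) : Dist1 K M :=
  fun n => ∑ᶠ m : Idx K, c m (n.1 - m.1 - 1, n.2 - m.2 - 1)

/-- multiplication by (𝐳−𝐰)^h (expansion in z>w), on coefficients;
first index is 𝐳, second is 𝐰 -/
def zwPow (h : Idx K) (c : Dist2 K M) : Dist2 K M :=
  fun m k => ∑ᶠ i : ℕ × ℕ,
    ((-1 : K) ^ (i.1 + i.2) * gchoose K h.1 i.1 * gchoose K h.2 i.2) •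
      c (m.1 + h.1 - i.1, m.2 + h.2 - i.2) (k.1 + i.1, k.2 + i.2)

/-- multiplication by ((𝐳−𝐰)_{w>z})^h = (−1)^h (𝐰−𝐳)^h (expansion in w>z) -/
def zwPowW (h : Idx K) (c : Dist2 K M) : Dist2 K M :=
  fun m k => ∑ᶠ i : ℕ × ℕ,
    (negOnePow K (h.1 - h.2) * (-1 : K) ^ (i.1 + i.2) *
        gchoose K h.1 i.1 * gchoose K h.2 i.2) •
      c (m.1 + i.1, m.2 + i.2) (k.1 + h.1 - i.1, k.2 + h.2 - i.2)

/-- multiplication by (𝐱+𝐰)^N of a distribution d(𝐰,𝐱) (first index 𝐰, second 𝐱);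
the result is indexed by (x-index, w-index) -/
def xwPow (N : Idx K) (d : Dist2 K M) : Dist2 K M :=
  fun m k => ∑ᶠ i : ℕ × ℕ, (gchoose K N.1 i.1 * gchoose K N.2 i.2) •
    d (k.1 + i.1, k.2 + i.2) (m.1 + N.1 - i.1, m.2 + N.2 - i.2)

/-- multiplication by (𝐰+𝐱)^N of a distribution d(𝐰,𝐱) (first index 𝐰, second 𝐱);
the result is indexed by (x-index, w-index) -/
def wxPow (N : Idx K) (d : Dist2 K M) : Dist2 K M :=
  fun m k => ∑ᶠ i : ℕ × ℕ, (gchoose K N.1 i.1 * gchoose K N.2 i.2) •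
    d (k.1 + N.1 - i.1, k.2 + N.2 - i.2) (m.1 + i.1, m.2 + i.2)

/-- multiplication by 𝐱^A 𝐰^B (𝐱+𝐰)^N of p(𝐰,𝐱); result indexed (x-index, w-index) -/
def tripleXW (A B N : Idx K) (p : Dist2 K M) : Dist2 K M :=
  fun m k => ∑ᶠ l : ℕ × ℕ, (gchoose K N.1 l.1 * gchoose K N.2 l.2) •
    p (k.1 + B.1 + l.1, k.2 + B.2 + l.2) (m.1 + A.1 + N.1 - l.1, m.2 + A.2 + N.2 - l.2)

/-- multiplication by 𝐱^A 𝐰^B (𝐰+𝐱)^N of p(𝐰,𝐱); result indexed (x-index, w-index) -/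
def tripleWX (A B N : Idx K) (p : Dist2 K M) : Dist2 K M :=
  fun m k => ∑ᶠ l : ℕ × ℕ, (gchoose K N.1 l.1 * gchoose K N.2 l.2) •
    p (k.1 + B.1 + N.1 - l.1, k.2 + B.2 + N.2 - l.2) (m.1 + A.1 + l.1, m.2 + A.2 + l.2)

variable (E : Type*) [AddCommGroup E] [Module K E]

/-- End(E)-valued distributions in one variable pair -/
abbrev EDist1 := Dist1 K (Module.End K E)

/-- End(E)-valued distributions in two variable pairs -/
abbrev EDist2 := Dist2 K (Module.End K E)

/-- End(E)-valued distributions in r variable pairs -/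
abbrev EDistN (r : ℕ) := DistN K (Module.End K E) r

def ev1 (a : EDist1 K E) (v : E) : Dist1 K E := fun n => a n v

def ev2 (c : EDist2 K E) (v : E) : Dist2 K E := fun n k => c n k v

def evN {r : ℕ} (c : EDistN K E r) (v : E) : DistN K E r := fun n => c n v

/-- a(𝐳) is a field -/
def IsFieldD (a : EDist1 K E) : Prop := ∀ v, InLat1 K E (ev1 K E a v)

/-- a field in two variable pairs -/
def IsField2D (c : EDist2 K E) : Prop := ∀ v, InLat2 K E (ev2 K E c v)

/-- the Koszul sign (−1)^{pq} -/
def koszul (p q : ZMod 2) : K := if p = 1 ∧ q = 1 then (-1 : K) else 1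

/-- the data (c^i, 𝐡_i) is an OPE of the homogeneous distributions a(𝐳), b(𝐳)
of parities pa, pb (all identities to be read applied to each vector of E) -/
def IsOPE (pa pb : ZMod 2) (a b : EDist1 K E) {r : ℕ}
    (c : Fin r → EDist2 K E) (h : Fin r → Idx K) : Prop :=
  (∀ i, Kbar K (h i)) ∧ (∀ i, IsField2D K E (c i)) ∧
  (∀ v m k, a m (b k v) = ∑ i, zwPow K E (-(h i)) (ev2 K E (c i) v) m k) ∧
  (∀ v m k, koszul K pa pb • (b k (a m v)) =
      ∑ i, zwPowW K E (-(h i)) (ev2 K E (c i) v) m k)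

/-- a(𝐳), b(𝐳) (homogeneous of parities pa, pb) are local -/
def IsLocal (pa pb : ZMod 2) (a b : EDist1 K E) : Prop :=
  ∃ (r : ℕ) (c : Fin r → EDist2 K E) (h : Fin r → Idx K), IsOPE K E pa pb a b c h

/-- the exponents of an OPE are reduced: 𝐡_i ∉ 𝐡_j + ℤ² for i ≠ j -/
def ReducedExp {r : ℕ} (h : Fin r → Idx K) : Prop :=
  ∀ i j, i ≠ j → ¬ IsIntPair K (h i - h j)

/-- the product field a(𝐰)_{(𝐧)}b(𝐰) built from an OPE (c,h), applied to a vector v -/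
def prodAt {r : ℕ} (c : Fin r → EDist2 K E) (h : Fin r → Idx K) (n : Idx K)
    (v : E) : Dist1 K E :=
  fun m => ∑ i, diag K E
    (ddPow2 K E ((h i).1 - 1 - n.1, (h i).2 - 1 - n.2) (ev2 K E (c i) v)) m

/-- s₁ : a(𝐳) ↦ a_{(−1,−1)}1 -/
def s1 (one : E) (a : EDist1 K E) : E := a ((-1 : K), (-1 : K)) one

/-- the distribution d (to be thought of as a(𝐳)1) equals
Σ_{𝐢∈ℕ²} T^{(i)} T̄^{(ī)} (d_{(−1,−1)}) 𝐳^𝐢, i.e. a(𝐳) is creative -/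
def CreativeD (T Tb : Module.End K E) (d : Dist1 K E) : Prop :=
  (∀ i : ℕ × ℕ, d (-(i.1 : K) - 1, -(i.2 : K) - 1) =
      ((i.1.factorial : K)⁻¹ * (i.2.factorial : K)⁻¹) •
        ((T ^ i.1) * (Tb ^ i.2)) (d ((-1 : K), (-1 : K)))) ∧
  (∀ n : Idx K, (¬ ∃ i : ℕ × ℕ, n = (-(i.1 : K) - 1, -(i.2 : K) - 1)) → d n = 0)

/-- a(𝐳) is translation covariant for (T, T̄) -/
def TransCov (T Tb : Module.End K E) (a : EDist1 K E) : Prop :=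
  (∀ n : Idx K, T * a n - a n * T = (-n.1) • a (n.1 - 1, n.2)) ∧
  (∀ n : Idx K, Tb * a n - a n * Tb = (-n.2) • a (n.1, n.2 - 1))

/-- translation covariance of a product field, per vector -/
def TransCovAt (T Tb : Module.End K E) (P : E → Dist1 K E) : Prop :=
  (∀ v (m : Idx K), T (P v m) - P (T v) m = (-m.1) • P v (m.1 - 1, m.2)) ∧
  (∀ v (m : Idx K), Tb (P v m) - P (Tb v) m = (-m.2) • P v (m.1, m.2 - 1))

/-- the identity field 1(z) = id_E -/
def idField : EDist1 K E :=
  fun n => if n = ((-1 : K), (-1 : K)) then (1 : Module.End K E) else 0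

/-- pairs i < j in [r] -/
abbrev Pairs (r : ℕ) := {p : Fin r × Fin r // p.1 < p.2}

/-- the index shift of the i-th variable produced by the monomial of a binomial
expansion of ((𝐳_{p₁} − 𝐳_{p₂})_σ)^h belonging to 𝐤 ∈ ℕ² -/
def pairShift {r : ℕ} (p : Pairs r) (h : Idx K) (flip : Bool) (kk : ℕ × ℕ)
    (i : Fin r) : Idx K :=
  if i = p.1.1 then
    (if flip then ((kk.1 : K), (kk.2 : K)) else (h.1 - kk.1, h.2 - kk.2))
  else if i = p.1.2 then
    (if flip then (h.1 - kk.1, h.2 - kk.2) else ((kk.1 : K), (kk.2 : K)))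
  else 0

/-- the coefficient of a binomial expansion of ((𝐳_{p₁} − 𝐳_{p₂})_σ)^h
belonging to 𝐤 ∈ ℕ² -/
def pairCoef (h : Idx K) (flip : Bool) (kk : ℕ × ℕ) : K :=
  (if flip then negOnePow K (h.1 - h.2) else 1) * (-1 : K) ^ (kk.1 + kk.2) *
    gchoose K h.1 kk.1 * gchoose K h.2 kk.2

def flipOf {r : ℕ} (σ : Equiv.Perm (Fin r)) (p : Pairs r) : Bool :=
  decide (σ.symm p.1.2 < σ.symm p.1.1)

/-- multiplication by Π_{i<j} ((𝐳_i − 𝐳_j)_σ)^{h_{ij}} on an r-variable distribution -/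
def permMul {r : ℕ} (σ : Equiv.Perm (Fin r)) (hs : Pairs r → Idx K)
    (c : DistN K M r) : DistN K M r :=
  fun m => ∑ᶠ κ : Pairs r → ℕ × ℕ,
    (∏ p : Pairs r, pairCoef K (hs p) (flipOf σ p) (κ p)) •
      c (fun i => m i + ∑ p : Pairs r, pairShift K p (hs p) (flipOf σ p) (κ p) i)

/-- the Koszul sign ζ' produced by reordering a¹,…,aʳ into a^{σ1},…,a^{σr} -/
def koszulPerm {r : ℕ} (ps : Fin r → ZMod 2) (σ : Equiv.Perm (Fin r)) : K :=
  ∏ p : Pairs r,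
    if σ.symm p.1.2 < σ.symm p.1.1 ∧ ps p.1.1 = 1 ∧ ps p.1.2 = 1 then (-1 : K) else 1

/-- the composition a^{σ1}(𝐳_{σ1})_{m_{σ1}} ∘ ⋯ ∘ a^{σr}(𝐳_{σr})_{m_{σr}} applied to v -/
def compSeq {r : ℕ} (a : Fin r → EDist1 K E) (σ : Equiv.Perm (Fin r))
    (m : Fin r → Idx K) (v : E) : E :=
  (List.ofFn fun j : Fin r => σ j).foldr (fun i acc => a i (m i) acc) v

/-- the data (c^α, 𝐡_{ij}^k) is a (multiple) OPE of the homogeneous distributions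
a¹(𝐳),…,aʳ(𝐳) of parities ps -/
def IsMultOPE {r : ℕ} (a : Fin r → EDist1 K E) (ps : Fin r → ZMod 2)
    (rij : Fin r → Fin r → ℕ) (hs : ∀ i j : Fin r, Fin (rij i j) → Idx K)
    (c : ((p : Pairs r) → Fin (rij p.1.1 p.1.2)) → EDistN K E r) : Prop :=
  (∀ i j k, Kbar K (hs i j k)) ∧
  (∀ α v, InLatN K E (evN K E (c α) v)) ∧
  (∀ σ : Equiv.Perm (Fin r), ∀ v m,
    koszulPerm K ps σ • compSeq K E a σ m v =
      ∑ α : (p : Pairs r) → Fin (rij p.1.1 p.1.2),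
        permMul K E σ (fun p => -(hs p.1.1 p.1.2 (α p))) (evN K E (c α) v) m)

/-- a¹(𝐳),…,aʳ(𝐳) are multiply local -/
def MultiplyLocal {r : ℕ} (a : Fin r → EDist1 K E) (ps : Fin r → ZMod 2) : Prop :=
  ∃ (rij : Fin r → Fin r → ℕ) (hs : ∀ i j : Fin r, Fin (rij i j) → Idx K)
    (c : ((p : Pairs r) → Fin (rij p.1.1 p.1.2)) → EDistN K E r),
      IsMultOPE K E a ps rij hs c

/-- a set of homogeneous fields (with parities pF) is multiply local -/
def MultLocalSet (F : Set (EDist1 K E)) (pF : EDist1 K E → ZMod 2) : Prop :=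
  ∀ (r : ℕ) (f : Fin r → EDist1 K E), (∀ i, f i ∈ F) →
    MultiplyLocal K E f (fun i => pF (f i))

/-- a set of homogeneous fields (with parities pF) is uniformly local -/
def UnifLocalSet (F : Set (EDist1 K E)) (pF : EDist1 K E → ZMod 2) (one : E) : Prop :=
  ∃ (rr : EDist1 K E → EDist1 K E → ℕ)
    (hh : ∀ d e : EDist1 K E, Fin (rr d e) → Idx K),
    ∀ (r : ℕ) (f : Fin r → EDist1 K E), (∀ i, f i ∈ F) →
      ∃ c, IsMultOPE K E f (fun i => pF (f i)) (fun i j => rr (f i) (f j))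
          (fun i j => hh (f i) (f j)) c ∧
        ∀ α, IsPowN K E (evN K E (c α) one)

/-- a ∈ V is homogeneous of parity p w.r.t. the grading (ev, od) -/
def memPar {V : Type*} [AddCommGroup V] [Module K V] (ev od : Submodule K V)
    (a : V) (p : ZMod 2) : Prop :=
  (p = 0 ∧ a ∈ ev) ∨ (p = 1 ∧ a ∈ od)

/-- an endomorphism is homogeneous of parity p w.r.t. the grading (ev, od) -/
def EndPar {V : Type*} [AddCommGroup V] [Module K V] (ev od : Submodule K V)
    (f : Module.End K V) (p : ZMod 2) : Prop :=
  if p = 0 then (∀ v ∈ ev, f v ∈ ev) ∧ (∀ v ∈ od, f v ∈ od)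
  else (∀ v ∈ ev, f v ∈ od) ∧ (∀ v ∈ od, f v ∈ ev)

/-- a distribution is homogeneous of parity p -/
def EDistPar {V : Type*} [AddCommGroup V] [Module K V] (ev od : Submodule K V)
    (a : EDist1 K V) (p : ZMod 2) : Prop :=
  ∀ n, EndPar K ev od (a n) p

end OPEA

namespace OPEA

/-- an OPE-algebra -/
structure OPEAlg (K : Type*) [Field K] [CharZero K]
    (V : Type*) [AddCommGroup V] [Module K V] where
  ev : Submodule K V
  od : Submodule K V
  compl : IsCompl ev od
  Y : V →ₗ[K] EDist1 K V
  Y_par : ∀ a p, memPar K ev od a p → ∀ (n : Idx K) b q, memPar K ev od b q →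
    memPar K ev od (Y a n b) (p + q)
  one : V
  one_ev : one ∈ ev
  T : Module.End K V
  Tb : Module.End K V
  T_ev : EndPar K ev od T 0
  Tb_ev : EndPar K ev od Tb 0
  commTTb : T * Tb = Tb * T
  T_one : T one = 0
  Tb_one : Tb one = 0
  wcre : ∀ a, IsPow1 K V (ev1 K V (Y a) one)
  rid : ∀ a, Y a ((-1 : K), (-1 : K)) one = a
  tcov : ∀ a, TransCov K V T Tb (Y a)
  loc : ∀ a b pa pb, memPar K ev od a pa → memPar K ev od b pb →
    IsLocal K V pa pb (Y a) (Y b)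

/-- a bounded 𝕂̄-fold algebra -/
structure BFold (K : Type*) [Field K] [CharZero K]
    (V : Type*) [AddCommGroup V] [Module K V] where
  ev : Submodule K V
  od : Submodule K V
  compl : IsCompl ev od
  Y : V →ₗ[K] EDist1 K V
  Y_par : ∀ a p, memPar K ev od a p → ∀ (n : Idx K) b q, memPar K ev od b q →
    memPar K ev od (Y a n b) (p + q)
  fields : ∀ a, IsFieldD K V (Y a)
  bounded : ∀ a (n : Idx K), ¬ Kbar K n → ∀ b, Y a n b = 0

/-- a bounded 𝕂̄-fold module over a bounded 𝕂̄-fold algebra -/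
structure BMod (K : Type*) [Field K] [CharZero K]
    (V : Type*) [AddCommGroup V] [Module K V] (A : BFold K V)
    (Mo : Type*) [AddCommGroup Mo] [Module K Mo] where
  evM : Submodule K Mo
  odM : Submodule K Mo
  complM : IsCompl evM odM
  YM : V →ₗ[K] EDist1 K Mo
  YM_par : ∀ a p, memPar K A.ev A.od a p → ∀ n : Idx K, EndPar K evM odM (YM a n) p
  fieldsM : ∀ a, IsFieldD K Mo (YM a)
  boundedM : ∀ a (n : Idx K), ¬ Kbar K n → ∀ c, YM a n c = 0

variable (K : Type*) [Field K] [CharZero K]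
variable (V : Type*) [AddCommGroup V] [Module K V]
variable (Mo : Type*) [AddCommGroup Mo] [Module K Mo]

/-- the operator T₁ : a ↦ a_{(−2,−1)}1 of an OPE-algebra -/
def T1 (A : OPEAlg K V) : Module.End K V where
  toFun := fun a => A.Y a ((-2 : K), (-1 : K)) A.one
  map_add' := by
    intro x y
    simp [map_add, Pi.add_apply, LinearMap.add_apply]
  map_smul' := by
    intro c x
    simp [map_smul, Pi.smul_apply, LinearMap.smul_apply]

/-- the operator T̄₁ : a ↦ a_{(−1,−2)}1 of an OPE-algebra -/
def T1b (A : OPEAlg K V) : Module.End K V where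
  toFun := fun a => A.Y a ((-1 : K), (-2 : K)) A.one
  map_add' := by
    intro x y
    simp [map_add, Pi.add_apply, LinearMap.add_apply]
  map_smul' := by
    intro c x
    simp [map_smul, Pi.smul_apply, LinearMap.smul_apply]

/-- skew-symmetry for the pair (T, T̄) -/
def SkewSym (ev od : Submodule K V) (Yf : V → EDist1 K V)
    (T Tb : Module.End K V) : Prop :=
  ∀ a b pa pb, memPar K ev od a pa → memPar K ev od b pb →
    ∀ n : Idx K, Kbar K n →
      (Function.support (fun i : ℕ × ℕ =>
        ((i.1.factorial : K)⁻¹ * (i.2.factorial : K)⁻¹ *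
            negOnePow K (n.1 + i.1 - (n.2 + i.2))) •
          ((T ^ i.1) * (Tb ^ i.2)) (Yf a (n.1 + i.1, n.2 + i.2) b))).Finite ∧
      koszul K pa pb • Yf b n a =
        ∑ᶠ i : ℕ × ℕ, ((i.1.factorial : K)⁻¹ * (i.2.factorial : K)⁻¹ *
            negOnePow K (n.1 + i.1 - (n.2 + i.2))) •
          ((T ^ i.1) * (Tb ^ i.2)) (Yf a (n.1 + i.1, n.2 + i.2) b)

/-- (T, T̄) is a translation endomorphism of the module with state-field map YM -/
def TransEnd (YM : V → EDist1 K Mo) (T Tb : Module.End K V) : Prop :=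
  (∀ a (n : Idx K), YM (T a) n = (-n.1) • YM a (n.1 - 1, n.2)) ∧
  (∀ a (n : Idx K), YM (Tb a) n = (-n.2) • YM a (n.1, n.2 - 1))

/-- the coefficient at (x-index m, w-index k) of a(𝐱+𝐰) applied to the w-distribution bw -/
def lhsXW (YM : V → EDist1 K Mo) (a : V) (bw : Dist1 K Mo) (m k : Idx K) : Mo :=
  ∑ᶠ i : ℕ × ℕ, ((i.1.factorial : K)⁻¹ * (i.2.factorial : K)⁻¹) •
    (((dz K (Module.End K Mo))^[i.1] ((dzb K (Module.End K Mo))^[i.2] (YM a))) m)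
      (bw (k.1 + i.1, k.2 + i.2))

/-- a and cM are dual in the direct channel -/
def DualDirect (Y : V → EDist1 K V) (YM : V → EDist1 K Mo) (a : V) (cM : Mo) : Prop :=
  ∃ (s : ℕ) (d : Fin s → Idx K → Idx K → (V →ₗ[K] Mo)) (hj : Fin s → Idx K),
    (∀ j, Kbar K (hj j)) ∧
    (∀ j b, InLat2 K Mo (fun kw mx => d j kw mx b)) ∧
    (∀ b (m k : Idx K),
      lhsXW K V Mo YM a (fun k' => YM b k' cM) m k =
        ∑ j, xwPow K Mo (-(hj j)) (fun kw mx => d j kw mx b) m k) ∧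
    (∀ b (m k : Idx K),
      YM (Y a m b) k cM =
        ∑ j, wxPow K Mo (-(hj j)) (fun kw mx => d j kw mx b) m k)

/-- a and b are dual in the exchange channel on the module -/
def DualExch (Y : V → EDist1 K V) (YM : V → EDist1 K Mo) (a b : V) : Prop :=
  ∃ (r : ℕ) (hab : Fin r → Idx K), (∀ i, Kbar K (hab i)) ∧
    ∀ cM : Mo, ∃ (s : ℕ) (hac : Fin s → Idx K)
      (q : Fin r → Fin s → Idx K → Idx K → Mo),
      (∀ j, Kbar K (hac j)) ∧
      (∀ i j kw mx, q i j kw mx ≠ 0 → IsNegInt K mx.1 ∧ IsNegInt K mx.2) ∧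
      (∀ i j mx, InLat1 K Mo (fun kw => q i j kw mx)) ∧
      (∀ m k : Idx K,
        lhsXW K V Mo YM a (fun k' => YM b k' cM) m k =
          ∑ j, xwPow K Mo (-(hac j))
            (fun kw mx => ∑ i, q i j kw (mx.1 - (hab i).1, mx.2 - (hab i).2)) m k) ∧
      (∀ m k : Idx K,
        YM (Y a m b) k cM =
          ∑ j, wxPow K Mo (-(hac j))
            (fun kw mx => ∑ i, q i j kw (mx.1 - (hab i).1, mx.2 - (hab i).2)) m k)

/-- the module with state-field map YM is dual -/
def IsDualMod (ev od : Submodule K V) (Y : V → EDist1 K V) (YM : V → EDist1 K Mo) : Prop :=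
  ∃ (rVV : V → V → ℕ) (hVV : ∀ a b : V, Fin (rVV a b) → Idx K)
    (rVM : V → Mo → ℕ) (hVM : ∀ (a : V) (c : Mo), Fin (rVM a c) → Idx K),
    (∀ a b i, Kbar K (hVV a b i)) ∧ (∀ a c j, Kbar K (hVM a c j)) ∧
    ∀ a b pa pb, memPar K ev od a pa → memPar K ev od b pb → ∀ c : Mo,
      ∃ p : Fin (rVV a b) → Fin (rVM a c) → Fin (rVM b c) → Dist2 K Mo,
        (∀ i j k, IsPow2 K Mo (p i j k)) ∧
        (∀ m k : Idx K,
          lhsXW K V Mo YM a (fun k' => YM b k' c) m k =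
            ∑ i, ∑ j, ∑ kk, tripleXW K Mo (-(hVV a b i)) (-(hVM b c kk))
              (-(hVM a c j)) (p i j kk) m k) ∧
        (∀ m k : Idx K,
          YM (Y a m b) k c =
            ∑ i, ∑ j, ∑ kk, tripleWX K Mo (-(hVV a b i)) (-(hVM b c kk))
              (-(hVM a c j)) (p i j kk) m k)

/-- F_Y is multiply local -/
def MultLocalAlg (A : OPEAlg K V) : Prop :=
  ∀ (r : ℕ) (f : Fin r → V) (pf : Fin r → ZMod 2),
    (∀ i, memPar K A.ev A.od (f i) (pf i)) →
      MultiplyLocal K V (fun i => A.Y (f i)) pf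

/-- F_Y is uniformly local -/
def UnifLocalAlg (A : OPEAlg K V) : Prop :=
  ∃ (rr : V → V → ℕ) (hh : ∀ a b : V, Fin (rr a b) → Idx K),
    ∀ (r : ℕ) (f : Fin r → V) (pf : Fin r → ZMod 2),
      (∀ i, memPar K A.ev A.od (f i) (pf i)) →
        ∃ c, IsMultOPE K V (fun i => A.Y (f i)) pf (fun i j => rr (f i) (f j))
            (fun i j => hh (f i) (f j)) c ∧
          ∀ α, IsPowN K V (evN K V (c α) A.one)

end OPEA
namespace OPEA

section Signs

variable {K : Type*} [Field K]

/-- A representative of the class of `x` modulo the image of `ℤ`. -/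
def intRep (x : K) : K :=
  (Quotient.out (QuotientAddGroup.mk x : K ⧸ (Int.castAddHom K).range))

theorem exists_intCast_add_intRep (x : K) : ∃ k : ℤ, (k : K) + intRep x = x := by
  have h : (QuotientAddGroup.mk (intRep x) : K ⧸ (Int.castAddHom K).range) =
      QuotientAddGroup.mk x := Quotient.out_eq _
  obtain ⟨k, hk⟩ := QuotientAddGroup.eq.1 h
  refine ⟨k, ?_⟩
  have hk' : (k : K) = -intRep x + x := hk
  rw [hk']
  ring

/-- The integer `k` with `x = k + intRep x`. -/
def intOffset (x : K) : ℤ := (exists_intCast_add_intRep x).choose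

theorem intOffset_add_intRep (x : K) : (intOffset x : K) + intRep x = x :=
  (exists_intCast_add_intRep x).choose_spec

theorem intRep_add_intCast (x : K) (k : ℤ) : intRep (x + k) = intRep x := by
  unfold intRep
  congr 1
  exact QuotientAddGroup.eq.2 ⟨-k, by simp⟩

variable [CharZero K]

theorem intOffset_add_intCast (x : K) (k : ℤ) : intOffset (x + k) = intOffset x + k := by
  have h1 := intOffset_add_intRep (x + k)
  rw [intRep_add_intCast] at h1
  have h2 := intOffset_add_intRep x
  have : (intOffset (x + k) : K) = ((intOffset x + k : ℤ) : K) := by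
    push_cast
    linear_combination h1 - h2
  exact_mod_cast this

/-- A sign `ε` on `K` with `ε (x + 1) = -ε x`. -/
def sgn (x : K) : K := (-1) ^ intOffset x

theorem sgn_add_one (x : K) : sgn (x + 1) = -sgn x := by
  have h := intOffset_add_intCast x 1
  rw [Int.cast_one] at h
  rw [sgn, sgn, h, zpow_add₀ (by simp)]
  simp

theorem negOnePow_intCast (k : ℤ) : negOnePow K (k : K) = (-1) ^ k := by
  have h : ∃ j : ℤ, (j : K) = (k : K) := ⟨k, rfl⟩
  rw [negOnePow, dif_pos h, Int.cast_injective h.choose_spec]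

theorem sgn_mul_sgn {n : Idx K} (hn : Kbar K n) :
    sgn n.1 * sgn n.2 = negOnePow K (n.1 - n.2) := by
  obtain ⟨k, hk⟩ := hn
  have h1 : n.1 = n.2 + k := by rw [hk]; ring
  have h2 := intOffset_add_intCast n.2 k
  rw [← hk, negOnePow_intCast, sgn, sgn, h1, h2, zpow_add₀ (by simp), mul_right_comm,
    ← mul_zpow]
  simp

end Signs

section Binomials

variable {K : Type*} [Field K]

theorem gchoose_neg (x : K) (n : ℕ) :
    (-1) ^ n * gchoose K ((n : K) - x - 1) n = gchoose K x n := by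
  rw [gchoose, gchoose, ← mul_div_assoc]
  congr 1
  rw [← Finset.prod_range_reflect, ← Finset.card_range n, ← Finset.prod_const,
    Finset.card_range, ← Finset.prod_mul_distrib]
  refine Finset.prod_congr rfl fun i hi => ?_
  have hi' : i + 1 ≤ n := Finset.mem_range.1 hi
  have : ((n - 1 - i : ℕ) : K) = n - 1 - i := by
    rw [Nat.sub_sub, Nat.cast_sub (by omega)]
    push_cast
    ring
  rw [this]
  ring

/-- The coefficient of `x ^ t` in `(1 - x) ^ h`, for an exponent `t` in `K`. -/
def binCoef (h t : K) : K :=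
  if ht : ∃ n : ℕ, (n : K) = t then (-1) ^ ht.choose * gchoose K h ht.choose else 0

theorem binCoef_of_not {h t : K} (ht : ¬ ∃ n : ℕ, (n : K) = t) : binCoef h t = 0 :=
  dif_neg ht

variable [CharZero K]

theorem gchoose_zero (x : K) : gchoose K x 0 = 1 := by simp [gchoose]

theorem succ_mul_gchoose_succ (x : K) (n : ℕ) :
    ((n : K) + 1) * gchoose K x (n + 1) = (x - n) * gchoose K x n := by
  have h1 : (n.factorial : K) ≠ 0 := Nat.cast_ne_zero.2 n.factorial_ne_zero
  have h2 : ((n : K) + 1) ≠ 0 := Nat.cast_add_one_ne_zero n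
  rw [gchoose, gchoose, Finset.prod_range_succ, Nat.factorial_succ]
  push_cast
  field_simp

theorem gchoose_succ_succ (x : K) (n : ℕ) :
    gchoose K (x + 1) (n + 1) = gchoose K x (n + 1) + gchoose K x n := by
  induction n with
  | zero =>
    have h1 := succ_mul_gchoose_succ (x + 1) 0
    have h2 := succ_mul_gchoose_succ x 0
    simp only [gchoose_zero, Nat.cast_zero] at h1 h2 ⊢
    linear_combination h1 - h2
  | succ n ih =>
    have h1 := succ_mul_gchoose_succ (x + 1) (n + 1)
    have h2 := succ_mul_gchoose_succ x (n + 1)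
    have h3 := succ_mul_gchoose_succ x n
    have h4 : ((n : K) + 1 + 1) ≠ 0 := by exact_mod_cast (n + 1).succ_ne_zero
    apply mul_left_cancel₀ h4
    push_cast at h1 h2 h3
    rw [ih] at h1
    linear_combination h1 - h2 - h3

theorem binCoef_natCast (h : K) (n : ℕ) : binCoef h (n : K) = (-1) ^ n * gchoose K h n := by
  have hn : ∃ m : ℕ, (m : K) = (n : K) := ⟨n, rfl⟩
  rw [binCoef, dif_pos hn, Nat.cast_injective hn.choose_spec]

theorem binCoef_zero_right (h : K) : binCoef h 0 = 1 := by
  simpa [gchoose_zero] using binCoef_natCast h 0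

theorem binCoef_zero_left {t : K} (ht : t ≠ 0) : binCoef 0 t = 0 := by
  by_cases h : ∃ n : ℕ, (n : K) = t
  · obtain ⟨n, rfl⟩ := h
    have hn : n ≠ 0 := fun h0 => ht (by simp [h0])
    rw [binCoef_natCast, gchoose, Finset.prod_eq_zero (i := 0) (by simpa using hn.bot_lt)
      (by simp)]
    simp
  · exact binCoef_of_not h

/-- The coefficient of `x ^ t` in the expansion of `(1 - x) ^ h` in powers of `x⁻¹`. -/
def binCoefInv (h t : K) : K := sgn h * binCoef h (h - t)

theorem binCoef_add_one (h t : K) : binCoef (h + 1) t = binCoef h t - binCoef h (t - 1) := by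
  by_cases ht : ∃ n : ℕ, (n : K) = t
  · obtain ⟨n, rfl⟩ := ht
    cases n with
    | zero =>
      have h1 : ¬ ∃ n : ℕ, (n : K) = ((0 : ℕ) : K) - 1 := by
        rintro ⟨n, hn⟩
        have : ((n + 1 : ℕ) : K) = 0 := by push_cast; rw [hn]; simp
        exact n.succ_ne_zero (by exact_mod_cast this)
      rw [binCoef_of_not h1]
      simp [binCoef_zero_right]
    | succ n =>
      have h1 : ((n + 1 : ℕ) : K) - 1 = (n : K) := by push_cast; ring
      rw [h1, binCoef_natCast, binCoef_natCast, binCoef_natCast, gchoose_succ_succ]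
      ring
  · have h1 : ¬ ∃ n : ℕ, (n : K) = t - 1 := by
      rintro ⟨n, hn⟩
      exact ht ⟨n + 1, by push_cast; rw [hn]; ring⟩
    rw [binCoef_of_not ht, binCoef_of_not ht, binCoef_of_not h1, sub_zero]

theorem binCoefInv_add_one (h t : K) :
    binCoefInv (h + 1) t = binCoefInv h t - binCoefInv h (t - 1) := by
  have h1 : h + 1 - t - 1 = h - t := by ring
  have h2 : h - (t - 1) = h + 1 - t := by ring
  rw [binCoefInv, binCoefInv, binCoefInv, sgn_add_one, binCoef_add_one, h1, h2]
  ring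

theorem binCoefInv_self (h : K) : binCoefInv h h = sgn h := by
  rw [binCoefInv, sub_self, binCoef_zero_right, mul_one]

end Binomials

section Transfer

variable {K : Type*} [Field K] [CharZero K] {M : Type*} [AddCommGroup M] [Module K M]

/-- Pascal's recursion expresses the values at `t - n` through the values at `t`. -/
theorem pascal_sub_natCast {φ : K → K → K} (hφ : ∀ h t, φ (h + 1) t = φ h t - φ h (t - 1))
    (n : ℕ) (h t : K) :
    φ h (t - n) = ∑ r ∈ Finset.range (n + 1), ((-1) ^ r * (n.choose r : K)) * φ (h + r) t := by
  induction n generalizing h t with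
  | zero => simp
  | succ n ih =>
    have h1 : t - ((n + 1 : ℕ) : K) = t - n - 1 := by push_cast; ring
    have h2 : φ h (t - n - 1) = φ h (t - n) - φ (h + 1) (t - n) := by rw [hφ]; ring
    rw [h1, h2, ih, ih, Finset.sum_range_succ' _ (n + 1), Finset.sum_range_succ' _ n,
      add_sub_right_comm]
    simp only [Nat.choose_succ_succ, Nat.cast_add, mul_add, add_mul, Finset.sum_add_distrib]
    rw [Finset.sum_range_succ (fun r => (-1) ^ (r + 1) * ((n.choose (r + 1) : ℕ) : K) *
      φ (h + (((r : ℕ) : K) + ((1 : ℕ) : K))) t) n]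
    simp only [Nat.choose_succ_self, Nat.cast_zero, mul_zero, zero_mul, add_zero,
      Nat.choose_zero_right]
    rw [add_comm (∑ r ∈ Finset.range (n + 1), _) (∑ r ∈ Finset.range n, _), sub_eq_add_neg,
      ← Finset.sum_neg_distrib]
    congr 2
    refine Finset.sum_congr rfl fun r _ => ?_
    have h3 : h + 1 + (r : K) = h + ((r : K) + ((1 : ℕ) : K)) := by push_cast; ring
    rw [h3]
    ring

/-- The functions `(1 - x) ^ g` for distinct `g` are linearly independent. -/
theorem sum_smul_eq_zero_of_gchoose {ι : Type*} (s : Finset ι) (g : ι → K) (e : ι → M)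
    (H : ∀ n : ℕ, ∑ j ∈ s, gchoose K (g j) n • e j = 0) (f : K → K) :
    ∑ j ∈ s, f (g j) • e j = 0 := by
  have hpow : ∀ n m : ℕ, ∑ j ∈ s, (g j ^ m * gchoose K (g j) n) • e j = 0 := by
    intro n m
    induction m generalizing n with
    | zero => simpa using H n
    | succ m ih =>
      have h1 : ∀ j, g j ^ (m + 1) * gchoose K (g j) n =
          ((n : K) + 1) * (g j ^ m * gchoose K (g j) (n + 1)) +
            (n : K) * (g j ^ m * gchoose K (g j) n) := fun j => by
        linear_combination (-(g j ^ m)) * succ_mul_gchoose_succ (g j) n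
      simp only [h1, add_smul, Finset.sum_add_distrib, mul_smul _ (_ * _), ← Finset.smul_sum,
        ih, smul_zero, add_zero]
  have hpoly : ∀ p : Polynomial K, ∑ j ∈ s, p.eval (g j) • e j = 0 := by
    intro p
    induction p using Polynomial.induction_on' with
    | add p q hp hq => simp [add_smul, Finset.sum_add_distrib, hp, hq]
    | monomial m c =>
      have := hpow 0 m
      simp only [gchoose_zero, mul_one] at this
      simp [mul_smul, ← Finset.smul_sum, this]
  rw [← hpoly (Lagrange.interpolate (s.image g) id f)]
  refine Finset.sum_congr rfl fun j hj => ?_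
  have := Lagrange.eval_interpolate_at_node (v := id) f (Function.injective_id.injOn)
    (Finset.mem_image_of_mem g hj)
  rw [id] at this
  rw [this]

/-- A relation between finitely many `x ^ (-q) * (1 - x) ^ h`, expanded in powers of `x`,
holds for every other coefficient function obeying Pascal's recursion. -/
theorem pascal_transfer {φ : K → K → K} (hφ : ∀ h t, φ (h + 1) t = φ h t - φ h (t - 1))
    {ι : Type*} (s : Finset ι) (h q : ι → K) (e : ι → M)
    (H : ∀ k, ∑ j ∈ s, binCoef (h j) (q j - k) • e j = 0) (k : K) :
    ∑ j ∈ s, φ (h j) (q j - k) • e j = 0 := by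
  obtain ⟨N, hN⟩ : ∃ N : ℤ, ∀ j ∈ s, intOffset (q j) ≤ N := by
    obtain ⟨N, hN⟩ := (s.image fun j => intOffset (q j)).bddAbove
    exact ⟨N, fun j hj => hN (by simpa using ⟨j, hj, rfl⟩)⟩
  set d : ι → ℕ := fun j => (N - intOffset (q j)).toNat with hd
  have hq : ∀ j ∈ s, ∀ k, q j - k = intRep (q j) + N - k - d j := by
    intro j hj k
    have h1 : ((d j : ℤ) : K) = N - intOffset (q j) := by
      rw [hd, Int.toNat_of_nonneg (sub_nonneg.2 (hN j hj))]
      push_cast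
      ring
    rw [Int.cast_natCast] at h1
    rw [h1]
    linear_combination -intOffset_add_intRep (q j)
  set s' : Finset (Σ _ : ι, ℕ) := s.sigma fun j => Finset.range (d j + 1) with hs'
  set e' : (Σ _ : ι, ℕ) → M := fun x => ((-1 : K) ^ x.2 * ((d x.1).choose x.2 : K)) • e x.1
    with he'
  have key : ∀ ψ : K → K → K, (∀ h t, ψ (h + 1) t = ψ h t - ψ h (t - 1)) → ∀ k,
      ∑ j ∈ s, ψ (h j) (q j - k) • e j =
        ∑ x ∈ s', ψ (h x.1 + x.2) (intRep (q x.1) + N - k) • e' x := by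
    intro ψ hψ k
    rw [hs', Finset.sum_sigma]
    refine Finset.sum_congr rfl fun j hj => ?_
    rw [hq j hj, pascal_sub_natCast hψ, Finset.sum_smul]
    refine Finset.sum_congr rfl fun r _ => ?_
    rw [he', smul_smul, mul_comm]
  rw [key φ hφ, ← Finset.sum_fiberwise_of_maps_to (t := s'.image fun x => intRep (q x.1))
    (g := fun x => intRep (q x.1)) (fun x hx => Finset.mem_image_of_mem _ hx)]
  refine Finset.sum_eq_zero fun ρ hρ => ?_
  obtain ⟨x₀, -, hx₀⟩ := Finset.mem_image.1 hρ
  have hz := sum_smul_eq_zero_of_gchoose (s'.filter fun x => intRep (q x.1) = ρ)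
    (fun x => h x.1 + x.2) e' (fun n => by
      have h0 := H (ρ + N - n)
      rw [key binCoef binCoef_add_one, ← Finset.sum_filter_add_sum_filter_not s'
        (fun x => intRep (q x.1) = ρ)] at h0
      have h1 : ∑ x ∈ s'.filter (fun x => ¬ intRep (q x.1) = ρ),
          binCoef (h x.1 + x.2) (intRep (q x.1) + N - (ρ + N - n)) • e' x = 0 := by
        refine Finset.sum_eq_zero fun x hx => ?_
        rw [binCoef_of_not, zero_smul]
        rintro ⟨m, hm⟩
        apply (Finset.mem_filter.1 hx).2
        have h2 : q x.1 = q x₀.1 + ((m - n + intOffset (q x.1) - intOffset (q x₀.1) : ℤ) : K) := by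
          push_cast
          rw [hm]
          linear_combination intOffset_add_intRep (q x₀.1) - intOffset_add_intRep (q x.1) -
            hx₀
        rw [h2, intRep_add_intCast, hx₀]
      rw [h1, add_zero] at h0
      have h3 : ∑ x ∈ s'.filter (fun x => intRep (q x.1) = ρ),
          (-1 : K) ^ n • gchoose K (h x.1 + x.2) n • e' x = 0 := by
        rw [← h0]
        refine Finset.sum_congr rfl fun x hx => ?_
        have h4 : intRep (q x.1) + N - (ρ + N - n) = (n : K) := by
          rw [(Finset.mem_filter.1 hx).2]
          ring
        rw [h4, binCoef_natCast, mul_smul]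
      rw [← Finset.smul_sum] at h3
      exact (smul_eq_zero.1 h3).resolve_left (by simp))
    (fun g => φ g (ρ + N - k))
  rw [← hz]
  refine Finset.sum_congr rfl fun x hx => ?_
  rw [(Finset.mem_filter.1 hx).2]

/-- The coefficient of `x ^ t.1 * x̄ ^ t.2` in `(1 - x) ^ h.1 * (1 - x̄) ^ h.2`. -/
def binCoef₂ (h t : Idx K) : K := binCoef h.1 t.1 * binCoef h.2 t.2

/-- The analogue of `binCoef₂` for the expansion in `x⁻¹` and `x̄⁻¹`. -/
def binCoefInv₂ (h t : Idx K) : K := binCoefInv h.1 t.1 * binCoefInv h.2 t.2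

theorem binCoef₂_transfer {ι : Type*} (s : Finset ι) (h q : ι → Idx K) (e : ι → M)
    (H : ∀ k, ∑ j ∈ s, binCoef₂ (h j) (q j - k) • e j = 0) (k : Idx K) :
    ∑ j ∈ s, binCoefInv₂ (h j) (q j - k) • e j = 0 := by
  have h1 : ∀ k₁ k₂ : K, ∑ j ∈ s, binCoefInv (h j).1 ((q j).1 - k₁) •
      binCoef (h j).2 ((q j).2 - k₂) • e j = 0 := fun k₁ k₂ =>
    pascal_transfer binCoefInv_add_one s (fun j => (h j).1) (fun j => (q j).1)
      (fun j => binCoef (h j).2 ((q j).2 - k₂) • e j)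
      (fun k => by simpa only [binCoef₂, mul_smul, Prod.fst_sub, Prod.snd_sub] using H (k, k₂)) k₁
  have h2 := pascal_transfer binCoefInv_add_one s (fun j => (h j).2) (fun j => (q j).2)
    (fun j => binCoefInv (h j).1 ((q j).1 - k.1) • e j)
    (fun k' => by simpa only [smul_comm (binCoef _ _)] using h1 k.1 k') k.2
  rw [← h2]
  refine Finset.sum_congr rfl fun j _ => ?_
  rw [binCoefInv₂, mul_comm, mul_smul, Prod.fst_sub, Prod.snd_sub]

theorem finsum_comp_eq_sum {α β : Type*} {g : α → β} (hg : Function.Injective g) (f : β → M)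
    (F : Finset β) (hF : Function.support f ⊆ F) (hr : Function.support f ⊆ Set.range g) :
    ∑ᶠ i, f (g i) = ∑ x ∈ F, f x := by
  rw [← finsum_mem_range hg]
  exact finsum_mem_eq_sum_of_inter_support_eq f
    (by rw [Set.inter_eq_right.2 hr, Set.inter_eq_right.2 hF])

theorem zwPow_eq_sum (h : Idx K) (c : Dist2 K M) (D k : Idx K) (F : Finset (Idx K))
    (hF : ∀ q, c (D + h - q) q ≠ 0 → q ∈ F) :
    zwPow K M h c (D - k) k = ∑ q ∈ F, binCoef₂ h (q - k) • c (D + h - q) q := by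
  have hg : Function.Injective (fun i : ℕ × ℕ => ((k.1 + i.1, k.2 + i.2) : Idx K)) := by
    rintro ⟨i, j⟩ ⟨i', j'⟩ hij
    simpa using hij
  rw [← finsum_comp_eq_sum hg (fun q => binCoef₂ h (q - k) • c (D + h - q) q) F]
  · refine finsum_congr fun i => ?_
    have e1 : binCoef₂ h ((k.1 + i.1, k.2 + i.2) - k) =
        (-1 : K) ^ (i.1 + i.2) * gchoose K h.1 i.1 * gchoose K h.2 i.2 := by
      simp only [binCoef₂, Prod.fst_sub, Prod.snd_sub, add_sub_cancel_left, binCoef_natCast]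
      ring
    rw [e1]
    congr 2
    ext <;> simp <;> ring
  · intro q hq
    exact hF q fun h0 => hq (by simp [h0])
  · intro q hq
    by_contra hr
    apply hq
    have : binCoef₂ h (q - k) = 0 := by
      rw [binCoef₂]
      by_cases h1 : ∃ n : ℕ, (n : K) = (q - k).1
      · by_cases h2 : ∃ n : ℕ, (n : K) = (q - k).2
        · obtain ⟨n₁, h1⟩ := h1
          obtain ⟨n₂, h2⟩ := h2
          exact absurd ⟨(n₁, n₂), by ext <;> simp [h1, h2]⟩ hr
        · rw [binCoef_of_not h2, mul_zero]
      · rw [binCoef_of_not h1, zero_mul]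
    simp [this]

theorem zwPowW_eq_sum (h : Idx K) (hh : Kbar K h) (c : Dist2 K M) (D k : Idx K)
    (F : Finset (Idx K)) (hF : ∀ q, c (D + h - q) q ≠ 0 → q ∈ F) :
    zwPowW K M h c (D - k) k = ∑ q ∈ F, binCoefInv₂ h (q - k) • c (D + h - q) q := by
  have hg : Function.Injective
      (fun i : ℕ × ℕ => ((k.1 + h.1 - i.1, k.2 + h.2 - i.2) : Idx K)) := by
    rintro ⟨i, j⟩ ⟨i', j'⟩ hij
    simpa using hij
  rw [← finsum_comp_eq_sum hg (fun q => binCoefInv₂ h (q - k) • c (D + h - q) q) F]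
  · refine finsum_congr fun i => ?_
    have e1 : binCoefInv₂ h ((k.1 + h.1 - i.1, k.2 + h.2 - i.2) - k) =
        negOnePow K (h.1 - h.2) * (-1 : K) ^ (i.1 + i.2) * gchoose K h.1 i.1 *
          gchoose K h.2 i.2 := by
      have a1 : h.1 - (k.1 + h.1 - i.1 - k.1) = (i.1 : K) := by ring
      have a2 : h.2 - (k.2 + h.2 - i.2 - k.2) = (i.2 : K) := by ring
      simp only [binCoefInv₂, binCoefInv, Prod.fst_sub, Prod.snd_sub, a1, a2, binCoef_natCast,
        ← sgn_mul_sgn hh]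
      ring
    rw [e1]
    congr 2
    ext <;> simp <;> ring
  · intro q hq
    exact hF q fun h0 => hq (by simp [h0])
  · intro q hq
    by_contra hr
    apply hq
    have : binCoefInv₂ h (q - k) = 0 := by
      rw [binCoefInv₂, binCoefInv, binCoefInv]
      by_cases h1 : ∃ n : ℕ, (n : K) = h.1 - (q - k).1
      · by_cases h2 : ∃ n : ℕ, (n : K) = h.2 - (q - k).2
        · obtain ⟨n₁, h1⟩ := h1
          obtain ⟨n₂, h2⟩ := h2
          refine absurd ⟨(n₁, n₂), ?_⟩ hr
          ext
          · simp only [h1, Prod.fst_sub]; ring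
          · simp only [h2, Prod.snd_sub]; ring
        · rw [binCoef_of_not h2, mul_zero, mul_zero]
      · rw [binCoef_of_not h1, mul_zero, zero_mul]
    simp [this]

end Transfer

section Finiteness

variable {K : Type*} [Field K] {M : Type*} [AddCommGroup M]

theorem IsNegInt.add {x y : K} (hx : IsNegInt K x) (hy : IsNegInt K y) :
    IsNegInt K (x + y) := by
  obtain ⟨k, hk, rfl⟩ := hx
  obtain ⟨l, hl, rfl⟩ := hy
  exact ⟨k + l, by omega, by push_cast; rfl⟩

variable [CharZero K]

theorem finite_isNegInt_add (x : K) : {l : ℕ | IsNegInt K (x + l)}.Finite := by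
  by_cases h : ∃ l₀ : ℕ, IsNegInt K (x + l₀)
  · obtain ⟨l₀, k₀, -, h₀⟩ := h
    refine (Set.finite_Iio ((l₀ : ℤ) - k₀).toNat).subset ?_
    rintro l ⟨k, hk, h1⟩
    have : (k : K) = ((k₀ + l - l₀ : ℤ) : K) := by
      push_cast
      rw [h1, h₀]
      ring
    have : k = k₀ + l - l₀ := by exact_mod_cast this
    simp only [Set.mem_Iio]
    omega
  · refine Set.finite_empty.subset fun l hl => h ⟨l, hl⟩

theorem finite_isNegInt_sub (x y : K) :
    {q : K | IsNegInt K (x - q) ∧ IsNegInt K (q - y)}.Finite := by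
  refine ((finite_isNegInt_add (x - y)).image fun l : ℕ => y - (l : K)).subset ?_
  rintro q ⟨h1, k, hk, h2⟩
  have hl : (((-k).toNat : ℤ) : K) = -(k : K) := by
    rw [Int.toNat_of_nonneg (by omega)]
    push_cast
    rfl
  rw [Int.cast_natCast] at hl
  refine ⟨(-k).toNat, ?_, ?_⟩
  · have : x - y + ((-k).toNat : K) = x - q := by
      rw [hl, h2]
      ring
    rw [Set.mem_ofPred_eq, this]
    exact h1
  · simp only [hl, h2]
    ring

theorem InLat2.finite_antidiagonal {c : Dist2 K M} (hc : InLat2 K M c) (D : Idx K) :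
    {q : Idx K | c (D - q) q ≠ 0}.Finite := by
  obtain ⟨S, hS⟩ := hc
  refine (S.finite_toSet.biUnion fun m _ =>
    (finite_isNegInt_sub (D.1 - m.1.1) m.2.1).prod
      (finite_isNegInt_sub (D.2 - m.1.2) m.2.2)).subset ?_
  intro q hq
  obtain ⟨m, hm, ⟨h1, h2⟩, h3, h4⟩ := hS _ _ hq
  refine Set.mem_biUnion hm ⟨⟨?_, h3⟩, ?_, h4⟩
  · rwa [sub_right_comm]
  · rwa [sub_right_comm]

theorem InLat2.finite_zwPow [Module K M] {c : Dist2 K M} (hc : InLat2 K M c) (h n k : Idx K) :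
    {l : ℕ × ℕ | zwPow K M h c (n.1 + l.1, n.2 + l.2) k ≠ 0}.Finite := by
  obtain ⟨S, hS⟩ := hc
  refine (S.finite_toSet.biUnion fun m _ =>
    (finite_isNegInt_add (n.1 + h.1 + k.1 - m.1.1 - m.2.1)).prod
      (finite_isNegInt_add (n.2 + h.2 + k.2 - m.1.2 - m.2.2))).subset ?_
  intro l hl
  have hl' : zwPow K M h c (n.1 + l.1, n.2 + l.2) k ≠ 0 := hl
  rw [zwPow, ← finsum_mem_univ] at hl'
  obtain ⟨i, -, hi⟩ := exists_ne_zero_of_finsum_mem_ne_zero hl'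
  obtain ⟨m, hm, ⟨h1, h2⟩, h3, h4⟩ := hS _ _ (right_ne_zero_of_smul hi)
  refine Set.mem_biUnion hm ⟨?_, ?_⟩
  · rw [Set.mem_ofPred_eq]
    convert h1.add h3 using 1
    ring
  · rw [Set.mem_ofPred_eq]
    convert h2.add h4 using 1
    ring

end Finiteness

section Local

variable {K : Type*} [Field K] [CharZero K] {E : Type*} [AddCommGroup E] [Module K E]

theorem IsLocal.finite_comp {pa pb : ZMod 2} {a b : EDist1 K E} (hab : IsLocal K E pa pb a b)
    (v : E) (n k : Idx K) :
    {l : ℕ × ℕ | a (n.1 + l.1, n.2 + l.2) (b k v) ≠ 0}.Finite := by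
  obtain ⟨r, c, h, -, hc, hF, -⟩ := hab
  refine (Set.finite_iUnion fun i : Fin r => (hc i v).finite_zwPow (-(h i)) n k).subset ?_
  intro l hl
  rw [Set.mem_ofPred_eq, hF] at hl
  obtain ⟨i, -, hi⟩ := Finset.exists_ne_zero_of_sum_ne_zero hl
  exact Set.mem_iUnion.2 ⟨i, hi⟩

/-- For local distributions, a finite expansion of `a(z)b(w)v` in total degree `D` determines
the one of `b(w)a(z)v`. -/
theorem IsLocal.transfer {pa pb : ZMod 2} {a b : EDist1 K E} (hab : IsLocal K E pa pb a b)
    (v : E) (D : Idx K) {ι : Type*} (s : Finset ι) (H Q : ι → Idx K) (e : ι → E)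
    (hab' : ∀ k, a (D - k) (b k v) = ∑ j ∈ s, binCoef₂ (H j) (Q j - k) • e j) (k : Idx K) :
    koszul K pa pb • b k (a (D - k) v) = ∑ j ∈ s, binCoefInv₂ (H j) (Q j - k) • e j := by
  obtain ⟨r, c, h, hh, hc, hF, hG⟩ := hab
  have hfin := fun i => (hc i v).finite_antidiagonal (D + -(h i))
  set F : Fin r → Finset (Idx K) := fun i => (hfin i).toFinset with hFdef
  have hmem : ∀ i q, ev2 K E (c i) v (D + -(h i) - q) q ≠ 0 → q ∈ F i := fun i q hq => by
    simpa [hFdef] using hq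
  have hneg : ∀ i, Kbar K (-(h i)) := fun i => by
    obtain ⟨l, hl⟩ := hh i
    exact ⟨-l, by push_cast; rw [hl, Prod.fst_neg, Prod.snd_neg]; ring⟩
  set t := s.disjSum ((Finset.univ : Finset (Fin r)).sigma F) with ht
  have key := binCoef₂_transfer t
    (Sum.elim H fun x => -(h x.1)) (Sum.elim Q fun x => x.2)
    (Sum.elim e fun x => -ev2 K E (c x.1) v (D + -(h x.1) - x.2) x.2) (fun k => by
      rw [ht, Finset.sum_disjSum, Finset.sum_sigma]
      simp only [Sum.elim_inl, Sum.elim_inr, smul_neg, Finset.sum_neg_distrib]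
      rw [← hab', hF, ← sub_eq_add_neg, sub_eq_zero]
      exact Finset.sum_congr rfl fun i _ => zwPow_eq_sum _ _ D k (F i) (hmem i)) k
  rw [ht, Finset.sum_disjSum, Finset.sum_sigma] at key
  simp only [Sum.elim_inl, Sum.elim_inr, smul_neg, Finset.sum_neg_distrib] at key
  rw [← sub_eq_add_neg, sub_eq_zero] at key
  rw [key, hG]
  exact Finset.sum_congr rfl fun i _ => zwPowW_eq_sum _ (hneg i) _ D k (F i) (hmem i)

/-- The divided power `T ^ (n)` of an endomorphism. -/
def divPow (T : Module.End K E) (n : ℕ) : Module.End K E := ((n.factorial : K)⁻¹) • T ^ n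

theorem succ_smul_divPow_succ (T : Module.End K E) (n : ℕ) :
    ((n : K) + 1) • divPow T (n + 1) = divPow T n * T := by
  have h1 : (n.factorial : K) ≠ 0 := Nat.cast_ne_zero.2 n.factorial_ne_zero
  have h2 : ((n : K) + 1) ≠ 0 := Nat.cast_add_one_ne_zero n
  rw [divPow, divPow, smul_smul, smul_mul_assoc, pow_succ, Nat.factorial_succ]
  congr 1
  push_cast
  field_simp

/-- Commuting a divided power past a sequence with `T * x m - x m * T = -m • x (m - 1)`. -/
theorem mul_divPow (T : Module.End K E) (x : K → Module.End K E)
    (hx : ∀ m, T * x m - x m * T = (-m) • x (m - 1)) (j : ℕ) (m : K) :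
    x m * divPow T j =
      ∑ p ∈ Finset.HasAntidiagonal.antidiagonal j, gchoose K m p.2 • (divPow T p.1 * x (m - p.2)) := by
  have hx' : ∀ m, x m * T = T * x m + m • x (m - 1) := fun m => by
    have := hx m
    rw [neg_smul, sub_eq_iff_eq_add] at this
    rw [this]
    abel
  induction j with
  | zero => simp [divPow, gchoose_zero]
  | succ j ih =>
    have hj : ((j : K) + 1) ≠ 0 := Nat.cast_add_one_ne_zero j
    apply smul_right_injective _ hj
    simp only
    have hL : ((j : K) + 1) • (x m * divPow T (j + 1)) =
        ∑ p ∈ Finset.HasAntidiagonal.antidiagonal j, (gchoose K m p.2 * ((p.1 : K) + 1)) •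
            (divPow T (p.1 + 1) * x (m - p.2)) +
        ∑ p ∈ Finset.HasAntidiagonal.antidiagonal j, (((p.2 : K) + 1) * gchoose K m (p.2 + 1)) •
            (divPow T p.1 * x (m - (p.2 + 1 : ℕ))) := by
      rw [← mul_smul_comm, succ_smul_divPow_succ, ← mul_assoc, ih, Finset.sum_mul,
        ← Finset.sum_add_distrib]
      refine Finset.sum_congr rfl fun p _ => ?_
      have h1 : m - (p.2 + 1 : ℕ) = m - p.2 - 1 := by push_cast; ring
      rw [smul_mul_assoc, mul_assoc, hx', mul_add, smul_add, ← mul_assoc,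
        ← succ_smul_divPow_succ, smul_mul_assoc, smul_smul, mul_smul_comm, smul_smul,
        succ_mul_gchoose_succ, h1, mul_comm (m - (p.2 : K))]
    have hR : ((j : K) + 1) • ∑ p ∈ Finset.HasAntidiagonal.antidiagonal (j + 1),
          gchoose K m p.2 • (divPow T p.1 * x (m - p.2)) =
        ∑ p ∈ Finset.HasAntidiagonal.antidiagonal (j + 1),
          ((gchoose K m p.2 * (p.1 : K)) • (divPow T p.1 * x (m - p.2)) +
            ((p.2 : K) * gchoose K m p.2) • (divPow T p.1 * x (m - p.2))) := by
      rw [Finset.smul_sum]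
      refine Finset.sum_congr rfl fun p hp => ?_
      have h1 : ((p.1 + p.2 : ℕ) : K) = ((j + 1 : ℕ) : K) := by
        rw [Finset.HasAntidiagonal.mem_antidiagonal.1 hp]
      push_cast at h1
      rw [← h1, smul_smul, ← add_smul]
      congr 1
      ring
    rw [hL, hR, Finset.sum_add_distrib]
    congr 1
    · rw [Finset.Nat.sum_antidiagonal_succ]
      simp
    · rw [Finset.Nat.sum_antidiagonal_succ']
      simp

end Local

section Algebra

variable {K : Type*} [Field K] [CharZero K] {V : Type*} [AddCommGroup V] [Module K V]
  (A : OPEAlg K V)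

theorem T_Y_one (a : V) (n : Idx K) :
    A.T (A.Y a n A.one) = (-n.1) • A.Y a (n.1 - 1, n.2) A.one := by
  have := LinearMap.congr_fun ((A.tcov a).1 n) A.one
  simpa [A.T_one] using this

theorem Tb_Y_one (a : V) (n : Idx K) :
    A.Tb (A.Y a n A.one) = (-n.2) • A.Y a (n.1, n.2 - 1) A.one := by
  have := LinearMap.congr_fun ((A.tcov a).2 n) A.one
  simpa [A.Tb_one] using this

theorem T1_eq : T1 K V A = A.T := by
  ext a
  have h := T_Y_one A a (-1, -1)
  have h1 : (-1 - 1 : K) = -2 := by norm_num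
  simp only [A.rid, h1, neg_neg, one_smul] at h
  exact h.symm

theorem T1b_eq : T1b K V A = A.Tb := by
  ext a
  have h := Tb_Y_one A a (-1, -1)
  have h1 : (-1 - 1 : K) = -2 := by norm_num
  simp only [A.rid, h1, neg_neg, one_smul] at h
  exact h.symm

theorem Y_one_natCast (a : V) (i j : ℕ) :
    A.Y a (-(i : K) - 1, -(j : K) - 1) A.one = divPow A.T i (divPow A.Tb j a) := by
  have hs : ∀ (T : Module.End K V) (n : ℕ),
      ((n : K) + 1) • divPow T (n + 1) = T * divPow T n := fun T n => by
    rw [succ_smul_divPow_succ, divPow, smul_mul_assoc, mul_smul_comm, pow_mul_comm']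
  have hb : ∀ j : ℕ, A.Y a (-1, -(j : K) - 1) A.one = divPow A.Tb j a := by
    intro j
    induction j with
    | zero => simpa [divPow] using A.rid a
    | succ j ih =>
      have hj : ((j : K) + 1) ≠ 0 := Nat.cast_add_one_ne_zero j
      apply smul_right_injective _ hj
      simp only
      rw [← LinearMap.smul_apply _ (divPow A.Tb (j + 1)), hs, Module.End.mul_apply, ← ih, Tb_Y_one]
      push_cast
      congr 2 <;> ring_nf
  induction i with
  | zero => simpa [divPow] using hb j
  | succ i ih =>
    have hi : ((i : K) + 1) ≠ 0 := Nat.cast_add_one_ne_zero i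
    apply smul_right_injective _ hi
    simp only
    rw [← LinearMap.smul_apply _ (divPow A.T (i + 1)), hs, Module.End.mul_apply, ← ih, T_Y_one]
    push_cast
    congr 2 <;> ring_nf

theorem Y_one_eq_zero (a : V) (n : Idx K)
    (hn : ¬ ∃ i : ℕ × ℕ, n = (-(i.1 : K) - 1, -(i.2 : K) - 1)) : A.Y a n A.one = 0 := by
  by_contra h
  obtain ⟨⟨k, hk, h1⟩, l, hl, h2⟩ := A.wcre a n h
  apply hn
  have hnat : ∀ k : ℤ, k < 0 → -(((-k - 1).toNat : ℕ) : K) - 1 = k := fun k hk => by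
    have : (((-k - 1).toNat : ℤ) : K) = -(k : K) - 1 := by
      rw [Int.toNat_of_nonneg (by omega)]
      push_cast
      rfl
    rw [Int.cast_natCast] at this
    rw [this]
    ring
  exact ⟨((-k - 1).toNat, (-l - 1).toNat),
    Prod.ext ((hnat k hk).trans h1).symm ((hnat l hl).trans h2).symm⟩

theorem divPow_apply_divPow (i j : ℕ) (a : V) :
    divPow A.T i (divPow A.Tb j a) =
      ((i.factorial : K)⁻¹ * (j.factorial : K)⁻¹) • ((A.T ^ i) * (A.Tb ^ j)) a := by
  simp [divPow, smul_smul, mul_comm]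

theorem Y_creative (a : V) : CreativeD K V A.T A.Tb (ev1 K V (A.Y a) A.one) := by
  refine ⟨fun i => ?_, fun n hn => Y_one_eq_zero A a n hn⟩
  simp only [ev1]
  rw [Y_one_natCast, A.rid, divPow_apply_divPow]

theorem memPar_one : memPar K A.ev A.od A.one 0 := Or.inl ⟨rfl, A.one_ev⟩

theorem Y_one_apply_of_memPar {a : V} {pa : ZMod 2} (ha : memPar K A.ev A.od a pa)
    (k : Idx K) : A.Y A.one k a = idField K V k a := by
  have hone : ∀ k : Idx K, A.Y A.one k A.one = if k = (-1, -1) then A.one else 0 := by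
    intro k
    split_ifs with hk
    · rw [hk, A.rid]
    · by_cases h : ∃ i : ℕ × ℕ, k = (-(i.1 : K) - 1, -(i.2 : K) - 1)
      · obtain ⟨⟨i, j⟩, rfl⟩ := h
        rw [Y_one_natCast]
        cases j with
        | succ j => simp [divPow, pow_succ, A.Tb_one]
        | zero =>
          cases i with
          | succ i => simp [divPow, pow_succ, A.T_one]
          | zero => simp at hk
      · exact Y_one_eq_zero A _ _ h
  have h0 : ∀ t : Idx K, t ≠ 0 → binCoef₂ 0 t = 0 := fun t ht => by
    by_cases h1 : t.1 = 0
    · have h2 : t.2 ≠ 0 := fun h2 => ht (Prod.ext h1 h2)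
      simp [binCoef₂, binCoef_zero_left h2]
    · simp [binCoef₂, binCoef_zero_left h1]
  have h00 : binCoef₂ (0 : Idx K) 0 = 1 := by simp [binCoef₂, binCoef_zero_right]
  have hinv : ∀ t : Idx K, binCoefInv₂ 0 t = binCoef₂ 0 (-t) := fun t => by
    have h := sgn_mul_sgn (n := (0 : Idx K)) ⟨0, by simp⟩
    have h1 := negOnePow_intCast (K := K) 0
    simp only [Prod.fst_zero, Prod.snd_zero, sub_zero, Int.cast_zero, zpow_zero] at h h1
    simp only [binCoefInv₂, binCoefInv, binCoef₂, Prod.fst_zero, Prod.snd_zero, zero_sub,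
      Prod.fst_neg, Prod.snd_neg]
    rw [mul_mul_mul_comm, h, h1, one_mul]
  have key := (A.loc a A.one pa 0 ha (memPar_one A)).transfer A.one (k + (-1, -1))
    {()} (fun _ => 0) (fun _ => (-1, -1)) (fun _ => A.Y a k A.one) (fun k' => by
      rw [hone, Finset.sum_singleton]
      split_ifs with hk
      · rw [hk, sub_self, h00, one_smul, add_sub_cancel_right]
      · rw [h0 _ (sub_ne_zero.2 (Ne.symm hk)), zero_smul, map_zero]) k
  rw [add_sub_cancel_left, A.rid, Finset.sum_singleton, hinv] at key
  simp only [koszul, zero_ne_one, and_false, if_false, one_smul] at key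
  rw [key, idField]
  split_ifs with hk
  · rw [hk, sub_self, neg_zero, h00, one_smul, A.rid]
    rfl
  · rw [h0 _ (neg_ne_zero.2 (sub_ne_zero.2 (Ne.symm hk))), zero_smul]
    rfl

theorem Y_one_eq_idField : A.Y A.one = idField K V := by
  ext k v
  obtain ⟨x, hx, y, hy, rfl⟩ := Submodule.mem_sup.1
    (A.compl.sup_eq_top ▸ Submodule.mem_top : v ∈ A.ev ⊔ A.od)
  rw [map_add, map_add, Y_one_apply_of_memPar A (Or.inl ⟨rfl, hx⟩),
    Y_one_apply_of_memPar A (Or.inr ⟨rfl, hy⟩)]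

theorem Y_apply_divPow (a b : V) (m : Idx K) (i j : ℕ) :
    A.Y a m (divPow A.T i (divPow A.Tb j b)) =
      ∑ p ∈ Finset.HasAntidiagonal.antidiagonal i, ∑ p' ∈ Finset.HasAntidiagonal.antidiagonal j,
        (gchoose K m.1 p.2 * gchoose K m.2 p'.2) •
          divPow A.T p.1 (divPow A.Tb p'.1 (A.Y a (m.1 - p.2, m.2 - p'.2) b)) := by
  have h1 := mul_divPow A.T (fun x => A.Y a (x, m.2)) (fun x => (A.tcov a).1 (x, m.2)) i m.1
  have h2 := fun x => mul_divPow A.Tb (fun y => A.Y a (x, y)) (fun y => (A.tcov a).2 (x, y))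
    j m.2
  have h1' := LinearMap.congr_fun h1 (divPow A.Tb j b)
  rw [Module.End.mul_apply, LinearMap.sum_apply] at h1'
  rw [h1']
  refine Finset.sum_congr rfl fun p _ => ?_
  have h2' := LinearMap.congr_fun (h2 (m.1 - p.2)) b
  rw [Module.End.mul_apply, LinearMap.sum_apply] at h2'
  rw [LinearMap.smul_apply, Module.End.mul_apply, h2', map_sum, Finset.smul_sum]
  refine Finset.sum_congr rfl fun p' _ => ?_
  rw [LinearMap.smul_apply, Module.End.mul_apply, map_smul, smul_smul]

theorem Y_Y_one_eq_sum (a b : V) (D : Idx K) (s : Finset (ℕ × ℕ))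
    (hs : ∀ l : ℕ × ℕ, A.Y a (D.1 + 1 + l.1, D.2 + 1 + l.2) b ≠ 0 → l ∈ s) (k : Idx K) :
    A.Y a (D - k) (A.Y b k A.one) =
      ∑ l ∈ s, binCoef₂ (-(D.1 + 1 + l.1) - 1, -(D.2 + 1 + l.2) - 1)
          ((-(l.1 : K) - 1, -(l.2 : K) - 1) - k) •
        divPow A.T l.1 (divPow A.Tb l.2 (A.Y a (D.1 + 1 + l.1, D.2 + 1 + l.2) b)) := by
  by_cases hk : ∃ i : ℕ × ℕ, k = (-(i.1 : K) - 1, -(i.2 : K) - 1)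
  · obtain ⟨⟨i, j⟩, rfl⟩ := hk
    set f : ℕ × ℕ → V := fun l => binCoef₂ (-(D.1 + 1 + l.1) - 1, -(D.2 + 1 + l.2) - 1)
          ((-(l.1 : K) - 1, -(l.2 : K) - 1) - (-(i : K) - 1, -(j : K) - 1)) •
        divPow A.T l.1 (divPow A.Tb l.2 (A.Y a (D.1 + 1 + l.1, D.2 + 1 + l.2) b)) with hf
    have hsum : ∑ l ∈ s, f l = ∑ l ∈ Finset.range (i + 1) ×ˢ Finset.range (j + 1), f l := by
      rw [← finsum_eq_sum_of_support_subset f (s := s), ← finsum_eq_sum_of_support_subset f]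
      · intro l hl
        by_contra hl'
        apply hl
        have hlt : i < l.1 ∨ j < l.2 := by
          simp only [Finset.coe_product, Set.mem_prod, Finset.mem_coe, Finset.mem_range] at hl'
          omega
        have hb : ∀ (h : K) (i l : ℕ), i < l →
            binCoef h (-(l : K) - 1 - (-(i : K) - 1)) = 0 := fun h i l hil => by
          apply binCoef_of_not
          rintro ⟨n, hn⟩
          have : ((n + l : ℕ) : K) = (i : K) := by push_cast; rw [hn]; ring
          have : n + l = i := by exact_mod_cast this
          omega
        rcases hlt with h | h
        · simp only [hf, binCoef₂, Prod.fst_sub, hb _ _ _ h, zero_mul, zero_smul]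
        · simp only [hf, binCoef₂, Prod.snd_sub, hb _ _ _ h, mul_zero, zero_smul]
      · intro l hl
        refine hs l fun h0 => hl ?_
        simp [hf, h0]
    rw [hsum, Y_one_natCast, Y_apply_divPow, Finset.sum_product,
      Finset.Nat.sum_antidiagonal_eq_sum_range_succ_mk]
    refine Finset.sum_congr rfl fun l hl => ?_
    rw [Finset.Nat.sum_antidiagonal_eq_sum_range_succ_mk]
    refine Finset.sum_congr rfl fun l' hl' => ?_
    have c1 : ((i - l : ℕ) : K) = i - l :=
      Nat.cast_sub (Nat.lt_succ_iff.1 (Finset.mem_range.1 hl))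
    have c2 : ((j - l' : ℕ) : K) = j - l' :=
      Nat.cast_sub (Nat.lt_succ_iff.1 (Finset.mem_range.1 hl'))
    have hc : ∀ (d : K) (i l : ℕ), ((i - l : ℕ) : K) = i - l →
        binCoef (-(d + 1 + l) - 1) (-(l : K) - 1 - (-(i : K) - 1)) =
          gchoose K (d - (-(i : K) - 1)) (i - l) := fun d i l c => by
      have e1 : -(l : K) - 1 - (-(i : K) - 1) = ((i - l : ℕ) : K) := by rw [c]; ring
      rw [e1, binCoef_natCast, ← gchoose_neg (d - (-(i : K) - 1)), c]
      congr 2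
      ring
    simp only [hf, binCoef₂, Prod.fst_sub, Prod.snd_sub, hc _ _ _ c1, hc _ _ _ c2, c1, c2]
    congr 6
    exact congrArg (A.Y a) (Prod.ext (by ring) (by ring))
  · rw [Y_one_eq_zero A b k hk, map_zero]
    symm
    refine Finset.sum_eq_zero fun l _ => ?_
    rw [binCoef₂]
    by_cases h1 : ∃ n : ℕ, (n : K) = -(l.1 : K) - 1 - k.1
    · by_cases h2 : ∃ n : ℕ, (n : K) = -(l.2 : K) - 1 - k.2
      · obtain ⟨n₁, h1⟩ := h1
        obtain ⟨n₂, h2⟩ := h2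
        refine absurd ⟨(n₁ + l.1, n₂ + l.2), ?_⟩ hk
        ext
        · push_cast
          rw [h1]
          ring
        · push_cast
          rw [h2]
          ring
      · rw [binCoef_of_not (t := Prod.snd _) h2, mul_zero, zero_smul]
    · rw [binCoef_of_not (t := Prod.fst _) h1, zero_mul, zero_smul]

theorem skewSym : SkewSym K V A.ev A.od (fun a => A.Y a) A.T A.Tb := by
  intro a b pa pb ha hb n hn
  have hloc := A.loc a b pa pb ha hb
  have hfin := hloc.finite_comp A.one n (-1, -1)
  rw [A.rid] at hfin
  have hsupp : ∀ g : ℕ × ℕ → K, Function.support (fun i : ℕ × ℕ =>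
      g i • ((A.T ^ i.1) * (A.Tb ^ i.2)) (A.Y a (n.1 + i.1, n.2 + i.2) b)) ⊆
        hfin.toFinset := by
    intro g i hi
    rw [Set.Finite.coe_toFinset]
    exact fun h0 => hi (by simp [h0])
  refine ⟨hfin.toFinset.finite_toSet.subset (hsupp _), ?_⟩
  rw [finsum_eq_sum_of_support_subset _ (hsupp _)]
  have e1 : n.1 + -1 + 1 = n.1 := by ring
  have e2 : n.2 + -1 + 1 = n.2 := by ring
  have key := hloc.transfer A.one (n + (-1, -1)) hfin.toFinset _ _ _
    (Y_Y_one_eq_sum A a b (n + (-1, -1)) hfin.toFinset (fun l hl => by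
      simpa only [Set.Finite.mem_toFinset, Set.mem_ofPred_eq, Prod.fst_add, Prod.snd_add, e1, e2]
        using hl)) n
  rw [add_sub_cancel_left, A.rid] at key
  rw [key]
  refine Finset.sum_congr rfl fun l _ => ?_
  have hcoef : binCoefInv₂
      (-(n.1 + -1 + 1 + (l.1 : K)) - 1, -(n.2 + -1 + 1 + (l.2 : K)) - 1)
      ((-(l.1 : K) - 1, -(l.2 : K) - 1) - n) = negOnePow K (n.1 + l.1 - (n.2 + l.2)) := by
    have a1 : -(n.1 + -1 + 1 + (l.1 : K)) - 1 = -(l.1 : K) - 1 - n.1 := by ring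
    have a2 : -(n.2 + -1 + 1 + (l.2 : K)) - 1 = -(l.2 : K) - 1 - n.2 := by ring
    simp only [binCoefInv₂, Prod.fst_sub, Prod.snd_sub, a1, a2, binCoefInv_self]
    obtain ⟨z, hz⟩ := hn
    have hz1 : n.1 + l.1 - (n.2 + l.2) = ((z + l.1 - l.2 : ℤ) : K) := by
      push_cast
      rw [hz]
      ring
    have hz2 : -(l.1 : K) - 1 - n.1 - (-(l.2 : K) - 1 - n.2) = ((-(z + l.1 - l.2) : ℤ) : K) := by
      push_cast
      rw [hz]
      ring
    have := sgn_mul_sgn (n := (-(l.1 : K) - 1 - n.1, -(l.2 : K) - 1 - n.2)) ⟨_, hz2.symm⟩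
    simp only at this
    rw [this, hz1, hz2, negOnePow_intCast, negOnePow_intCast, zpow_neg, ← inv_zpow]
    simp
  simp only [Prod.fst_add, Prod.snd_add]
  rw [hcoef, divPow_apply_divPow, smul_smul, mul_comm, e1, e2]

end Algebra

/-- every OPE-algebra satisfies skew-symmetry for 𝐓 = 𝐓₁, and is
unital: Y(1) = 1(z) = id and 1 is a right identity (every Ya is creative). -/
theorem stmt_12 (K : Type*) [Field K] [CharZero K]
    (V : Type*) [AddCommGroup V] [Module K V]
    (A : OPEAlg K V) :
    SkewSym K V A.ev A.od (fun a => A.Y a) (T1 K V A) (T1b K V A) ∧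
    A.Y A.one = idField K V ∧
    (∀ a : V, CreativeD K V (T1 K V A) (T1b K V A) (ev1 K V (A.Y a) A.one)) := by
  rw [T1_eq, T1b_eq]
  exact ⟨skewSym A, Y_one_eq_idField A, Y_creative A⟩

end OPEA
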